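/- arXiv:2206.00109 — 8 statements merged into one kernel-verified Lean document; each statement's English description precedes it below -/
import Mathlib

section
/- Let H be an r-uniform hypergraph with n vertices, m edges, maximum degree d_1 and minimum degree d_n. Then the first Zagreb index M = Σ_{i=1}^n d_i² satisfies M ≤ (d_1 + d_n)·r·m − n·d_1·d_n, with equality if and only if every vertex degree d_i equals d_1 or d_n. -/
/-- Handshake identity: in an `r`-uniform hypergraph the vertex degrees sum to `r` times the
number of edges. -/
theorem sum_card_filter_mem_of_uniform {α : Type*} [Fintype α] [DecidableEq α] {r : ℕ}
    {H : Finset (Finset α)} (hH : ∀ e ∈ H, e.card = r) :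
    ∑ i, (H.filter (fun e => i ∈ e)).card = r * H.card := by
  simp_rw [Finset.card_filter]
  rw [Finset.sum_comm]
  simp [Finset.sum_const_nat hH, mul_comm]

/-- For an `r`-uniform hypergraph `H` on `n` vertices with `m = H.card`
edges, degree function `d`, maximum degree `d1` and minimum degree `dn`, the first Zagreb
index `M = ∑ dᵢ²` satisfies `M ≤ (d1 + dn)·r·m − n·d1·dn`, with equality if and only if
every degree equals `d1` or `dn`. -/
theorem stmt_2 (n r : ℕ) (H : Finset (Finset (Fin n)))
    (hH : ∀ e ∈ H, e.card = r)
    (d : Fin n → ℕ) (hd : ∀ i, d i = (H.filter (fun e => i ∈ e)).card)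
    (d1 dn : ℕ) (hd1 : IsGreatest (Set.range d) d1) (hdn : IsLeast (Set.range d) dn) :
    (∑ i, (d i : ℝ) ^ 2 ≤ ((d1 : ℝ) + (dn : ℝ)) * r * H.card - (n : ℝ) * d1 * dn) ∧
    (∑ i, (d i : ℝ) ^ 2 = ((d1 : ℝ) + (dn : ℝ)) * r * H.card - (n : ℝ) * d1 * dn ↔
      ∀ i, d i = d1 ∨ d i = dn) := by
  have hsum : ∑ i, (d i : ℝ) = r * H.card := by
    simp_rw [hd]
    exact_mod_cast sum_card_filter_mem_of_uniform hH
  have hgap : ∑ i, ((d1 : ℝ) - d i) * (d i - dn) =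
      ((d1 : ℝ) + dn) * r * H.card - n * d1 * dn - ∑ i, (d i : ℝ) ^ 2 := by
    have hexp : ∀ i, ((d1 : ℝ) - d i) * (d i - dn) =
        (d1 + dn) * d i - d1 * dn - (d i : ℝ) ^ 2 := fun i => by ring
    simp_rw [hexp, Finset.sum_sub_distrib, ← Finset.mul_sum, hsum]
    simp only [Finset.sum_const, Finset.card_univ, Fintype.card_fin, nsmul_eq_mul]
    ring
  have hnonneg : ∀ i ∈ Finset.univ, 0 ≤ ((d1 : ℝ) - d i) * (d i - dn) := fun i _ =>
    mul_nonneg (sub_nonneg.2 (Nat.cast_le.2 (hd1.2 ⟨i, rfl⟩)))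
      (sub_nonneg.2 (Nat.cast_le.2 (hdn.2 ⟨i, rfl⟩)))
  refine ⟨by linarith [Finset.sum_nonneg hnonneg], ?_⟩
  rw [eq_comm, ← sub_eq_zero, ← hgap, Finset.sum_eq_zero_iff_of_nonneg hnonneg]
  simp only [Finset.mem_univ, true_imp_iff, mul_eq_zero, sub_eq_zero, Nat.cast_inj,
    eq_comm (a := d1)]
end

section
/- Let G be a finite simple graph on n vertices with degree sequence d_1, ..., d_n and let η be the number of triangles of G. Then the trace of the cube of the Laplacian matrix L = D − A of G equals Σ_{i=1}^n d_i³ + 3·Σ_{i=1}^n d_i² − 6·η. (This is the order-3 trace formula of the paper's Theorem 3.1 in the case r = 2.) -/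
namespace SimpleGraph

variable {V : Type*} [Fintype V] [DecidableEq V] (G : SimpleGraph V) [DecidableRel G.Adj]

/-- Every triangle has exactly six orderings of its vertices. -/
theorem card_filter_adj_triple_eq_six_mul_card_cliqueFinset :
    (Finset.univ.filter fun t : V × V × V =>
      G.Adj t.1 t.2.1 ∧ G.Adj t.2.1 t.2.2 ∧ G.Adj t.2.2 t.1).card =
      6 * (G.cliqueFinset 3).card := by
  rw [Finset.card_eq_sum_card_fiberwise (f := fun t : V × V × V => {t.1, t.2.1, t.2.2})
    (t := G.cliqueFinset 3), Finset.sum_const_nat (m := 6), mul_comm]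
  · intro s hs
    obtain ⟨a, b, c, hab, hac, hbc, rfl⟩ := is3Clique_iff.1 (mem_cliqueFinset_iff.1 hs)
    have hne := hab.ne
    have hne' := hac.ne
    have hne'' := hbc.ne
    have key : (Finset.univ.filter fun t : V × V × V =>
        G.Adj t.1 t.2.1 ∧ G.Adj t.2.1 t.2.2 ∧ G.Adj t.2.2 t.1).filter
          (fun t => ({t.1, t.2.1, t.2.2} : Finset V) = {a, b, c}) =
        {(a, b, c), (a, c, b), (b, a, c), (b, c, a), (c, a, b), (c, b, a)} := by
      ext ⟨x, y, z⟩
      simp only [Finset.mem_filter, Finset.mem_univ, true_and, Finset.mem_insert,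
        Finset.mem_singleton, Prod.mk.injEq]
      constructor
      · rintro ⟨⟨hxy, hyz, hzx⟩, h⟩
        have hx : x ∈ ({a, b, c} : Finset V) := by simp [← h]
        have hy : y ∈ ({a, b, c} : Finset V) := by simp [← h]
        have hz : z ∈ ({a, b, c} : Finset V) := by simp [← h]
        simp only [Finset.mem_insert, Finset.mem_singleton] at hx hy hz
        have h1 := hxy.ne
        have h2 := hyz.ne
        have h3 := hzx.ne
        grind
      · have hba := hab.symm
        have hca := hac.symm
        have hcb := hbc.symm
        rintro (⟨rfl, rfl, rfl⟩ | ⟨rfl, rfl, rfl⟩ | ⟨rfl, rfl, rfl⟩ | ⟨rfl, rfl, rfl⟩ |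
          ⟨rfl, rfl, rfl⟩ | ⟨rfl, rfl, rfl⟩) <;>
        refine ⟨⟨by assumption, by assumption, by assumption⟩, ?_⟩ <;> grind
    rw [key]
    simp [hne, hne', hne'', hne.symm, hne'.symm, hne''.symm]
  · rintro ⟨x, y, z⟩ h
    simp only [Finset.coe_filter, Finset.mem_univ, true_and, Set.mem_ofPred_eq] at h
    simpa [is3Clique_triple_iff] using ⟨h.1, h.2.2.symm, h.2.1⟩

/-- The trace of the cube of the adjacency matrix is six times the number of triangles. -/
theorem trace_adjMatrix_pow_three (R : Type*) [Semiring R] :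
    Matrix.trace (G.adjMatrix R ^ 3) = 6 * ((G.cliqueFinset 3).card : R) := by
  have h := congrArg (Nat.cast : ℕ → R) G.card_filter_adj_triple_eq_six_mul_card_cliqueFinset
  push_cast at h
  rw [← h, Finset.card_filter, Fintype.sum_prod_type]
  simp only [Fintype.sum_prod_type, Nat.cast_sum, Matrix.trace, Matrix.diag_apply, pow_three,
    Matrix.mul_apply, Finset.mul_sum, adjMatrix_apply]
  refine Finset.sum_congr rfl fun a _ => Finset.sum_congr rfl fun b _ =>
    Finset.sum_congr rfl fun c _ => ?_
  by_cases hab : G.Adj a b <;> by_cases hbc : G.Adj b c <;> by_cases hca : G.Adj c a <;>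
    simp [hab, hbc, hca]

/-- The trace of the cube of the Laplacian in terms of degrees and triangles. -/
theorem trace_lapMatrix_pow_three (R : Type*) [CommRing R] :
    Matrix.trace (G.lapMatrix R ^ 3) =
      ∑ i, (G.degree i : R) ^ 3 + 3 * ∑ i, (G.degree i : R) ^ 2
        - 6 * ((G.cliqueFinset 3).card : R) := by
  rw [← trace_adjMatrix_pow_three, lapMatrix]
  set A := G.adjMatrix R with hA
  set D := G.degMatrix R with hD
  have hDDD : Matrix.trace (D ^ 3) = ∑ i, (G.degree i : R) ^ 3 := by
    simp [hD, degMatrix, Matrix.diagonal_pow, Matrix.trace_diagonal]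
  have hDDA : Matrix.trace (D * D * A) = 0 := by
    simp only [hD, hA, degMatrix, Matrix.diagonal_mul_diagonal, Matrix.trace, Matrix.diag_apply,
      Matrix.diagonal_mul, adjMatrix_apply, G.irrefl, if_false, mul_zero, Finset.sum_const_zero]
  have hDAA : Matrix.trace (D * (A * A)) = ∑ i, (G.degree i : R) ^ 2 := by
    simp only [hD, hA, degMatrix, Matrix.trace, Matrix.diag_apply, Matrix.diagonal_mul,
      adjMatrix_mul_self_apply_self, sq]
  have hDAD : Matrix.trace (D * A * D) = Matrix.trace (D * D * A) := by
    rw [Matrix.trace_mul_comm, mul_assoc]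
  have hADD : Matrix.trace (A * (D * D)) = Matrix.trace (D * D * A) := Matrix.trace_mul_comm _ _
  have hADA : Matrix.trace (A * D * A) = Matrix.trace (D * (A * A)) := by
    rw [mul_assoc, Matrix.trace_mul_comm, mul_assoc]
  have hAAD : Matrix.trace (A * A * D) = Matrix.trace (D * (A * A)) := Matrix.trace_mul_comm _ _
  have hexp : (D - A) ^ 3 = D ^ 3 - D * D * A - D * A * D - A * (D * D)
      + D * (A * A) + A * D * A + A * A * D - A ^ 3 := by noncomm_ring
  rw [hexp]
  simp only [Matrix.trace_sub, Matrix.trace_add, hDAD, hADD, hADA, hAAD, hDDD, hDDA, hDAA]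
  ring

end SimpleGraph

/-- For a finite simple graph `G` on `n` vertices with `η` triangles,
the trace of the cube of the Laplacian matrix `L = D − A` equals
`∑ dᵢ³ + 3·∑ dᵢ² − 6·η`. -/
theorem stmt_7 (n : ℕ) (G : SimpleGraph (Fin n)) [DecidableRel G.Adj] :
    Matrix.trace ((G.lapMatrix ℝ) ^ 3) =
      ∑ i, (G.degree i : ℝ) ^ 3 + 3 * ∑ i, (G.degree i : ℝ) ^ 2
        - 6 * ((G.cliqueFinset 3).card : ℝ) :=
  G.trace_lapMatrix_pow_three ℝ
end

section
/- Let G be a finite simple graph with n ≥ 1 vertices, m edges, degree sequence d_1, ..., d_n, and η triangles. Then the Laplacian Estrada index satisfies LEE(G) ≥ n + (1/6)·Σ_{i=1}^n d_i³ + (1 − m/n)·Σ_{i=1}^n d_i² + m + 8m³/(3n²) − 4m²/n − η. -/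
/-- The third-order Taylor polynomial of `exp` at `0` is a global lower bound for `exp`. -/
theorem Real.cubic_le_exp (x : ℝ) : 1 + x + x ^ 2 / 2 + x ^ 3 / 6 ≤ Real.exp x := by
  obtain hx | hx := le_total 0 x
  · simpa [Finset.sum_range_succ, Nat.factorial] using Real.sum_le_exp_of_nonneg hx 4
  have hquad : ∀ y : ℝ, HasDerivAt (fun y ↦ Real.exp y - (1 + y + y ^ 2 / 2))
      (Real.exp y - (1 + y)) y := fun y ↦ by
    refine ((Real.hasDerivAt_exp y).sub (((hasDerivAt_id y).const_add 1).add
      ((hasDerivAt_pow 2 y).div_const 2))).congr_deriv ?_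
    norm_num
  have hmono : Monotone fun y : ℝ ↦ Real.exp y - (1 + y + y ^ 2 / 2) :=
    monotone_of_hasDerivAt_nonneg hquad fun y ↦ by
      simpa [add_comm] using Real.add_one_le_exp y
  have hcubic : ∀ y : ℝ, HasDerivAt (fun y ↦ Real.exp y - (1 + y + y ^ 2 / 2 + y ^ 3 / 6))
      (Real.exp y - (1 + y + y ^ 2 / 2)) y := fun y ↦ by
    refine ((Real.hasDerivAt_exp y).sub ((((hasDerivAt_id y).const_add 1).add
      ((hasDerivAt_pow 2 y).div_const 2)).add ((hasDerivAt_pow 3 y).div_const 6))).congr_deriv ?_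
    norm_num
    ring
  have hanti : AntitoneOn (fun y : ℝ ↦ Real.exp y - (1 + y + y ^ 2 / 2 + y ^ 3 / 6))
      (Set.Iic 0) :=
    antitoneOn_of_hasDerivWithinAt_nonpos (convex_Iic 0)
      (fun y _ ↦ (hcubic y).continuousAt.continuousWithinAt)
      (fun y _ ↦ (hcubic y).hasDerivWithinAt) fun y hy ↦ by
        simpa using hmono (Set.mem_Iic.1 (interior_subset hy))
  simpa using hanti hx (Set.mem_Iic.2 le_rfl) hx

/-- The trace of a power of a real Hermitian matrix is the power sum of its eigenvalues. -/
theorem Matrix.IsHermitian.trace_pow_eq_sum_eigenvalues_pow {V : Type*} [Fintype V]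
    [DecidableEq V] {A : Matrix V V ℝ} (hA : A.IsHermitian) (k : ℕ) :
    (A ^ k).trace = ∑ i, hA.eigenvalues i ^ k := by
  conv_lhs => rw [hA.spectral_theorem, ← map_pow, Matrix.diagonal_pow]
  rw [Unitary.conjStarAlgAut_apply, Matrix.trace_mul_cycle, Unitary.coe_star_mul_self, one_mul,
    Matrix.trace_diagonal]
  simp

namespace SimpleGraph

variable {V : Type*} [Fintype V] [DecidableEq V] (G : SimpleGraph V) [DecidableRel G.Adj]

theorem trace_degMatrix_pow (k : ℕ) :
    (G.degMatrix ℝ ^ k).trace = ∑ i, (G.degree i : ℝ) ^ k := by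
  simp [degMatrix, Matrix.diagonal_pow, Matrix.trace_diagonal]

theorem trace_degMatrix_pow_mul_adjMatrix (k : ℕ) :
    (G.degMatrix ℝ ^ k * G.adjMatrix ℝ).trace = 0 := by
  simp only [degMatrix, Matrix.diagonal_pow, Matrix.trace, Matrix.diag_apply,
    Matrix.diagonal_mul]
  simp

theorem trace_degMatrix_pow_mul_adjMatrix_sq (k : ℕ) :
    (G.degMatrix ℝ ^ k * G.adjMatrix ℝ ^ 2).trace = ∑ i, (G.degree i : ℝ) ^ (k + 1) := by
  simp only [degMatrix, Matrix.diagonal_pow, Matrix.trace, Matrix.diag_apply,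
    Matrix.diagonal_mul, pow_two (G.adjMatrix ℝ), adjMatrix_mul_self_apply_self, Pi.pow_apply,
    pow_succ]

theorem trace_lapMatrix : (G.lapMatrix ℝ).trace = ∑ i, (G.degree i : ℝ) := by
  simp [lapMatrix, degMatrix, Matrix.trace_diagonal]

theorem trace_lapMatrix_sq :
    (G.lapMatrix ℝ ^ 2).trace = ∑ i, (G.degree i : ℝ) ^ 2 + ∑ i, (G.degree i : ℝ) := by
  have h : G.lapMatrix ℝ ^ 2 = G.degMatrix ℝ ^ 2 - G.degMatrix ℝ * G.adjMatrix ℝ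
      - G.adjMatrix ℝ * G.degMatrix ℝ + G.adjMatrix ℝ ^ 2 := by
    rw [lapMatrix]; noncomm_ring
  have h₁ := G.trace_degMatrix_pow_mul_adjMatrix 1
  have h₂ := G.trace_degMatrix_pow_mul_adjMatrix_sq 0
  simp only [pow_one, pow_zero, one_mul, zero_add] at h₁ h₂
  rw [h, Matrix.trace_add, Matrix.trace_sub, Matrix.trace_sub,
    Matrix.trace_mul_comm (G.adjMatrix ℝ), h₁, h₂, trace_degMatrix_pow]
  ring

theorem trace_lapMatrix_cube :
    (G.lapMatrix ℝ ^ 3).trace = ∑ i, (G.degree i : ℝ) ^ 3 + 3 * ∑ i, (G.degree i : ℝ) ^ 2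
      - (G.adjMatrix ℝ ^ 3).trace := by
  have h₁ := G.trace_degMatrix_pow_mul_adjMatrix 2
  have h₂ := G.trace_degMatrix_pow_mul_adjMatrix_sq 1
  have h₃ := G.trace_degMatrix_pow 3
  rw [lapMatrix]
  generalize G.degMatrix ℝ = D at *
  generalize G.adjMatrix ℝ = A at *
  have h : (D - A) ^ 3 = D ^ 3 - (D ^ 2 * A + D * A * D + A * D ^ 2)
      + (D * A ^ 2 + A * D * A + A ^ 2 * D) - A ^ 3 := by
    noncomm_ring
  have e₁ : (D * A * D).trace = (D ^ 2 * A).trace := by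
    rw [Matrix.trace_mul_comm, ← mul_assoc, pow_two]
  have e₂ : (A * D * A).trace = (D * A ^ 2).trace := by
    rw [mul_assoc, Matrix.trace_mul_comm, mul_assoc, pow_two]
  rw [pow_one] at h₂
  rw [h]
  simp only [Matrix.trace_add, Matrix.trace_sub]
  rw [Matrix.trace_mul_comm A, Matrix.trace_mul_comm (A ^ 2), e₁, e₂, h₁, h₂, h₃]
  ring

/-- Each triangle is traversed by at most six closed walks of length three. -/
theorem trace_adjMatrix_cube_le :
    (G.adjMatrix ℝ ^ 3).trace ≤ 6 * ((G.cliqueFinset 3).card : ℝ) := by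
  let T : Finset (V × V × V) :=
    {p | G.Adj p.1 p.2.1 ∧ G.Adj p.2.1 p.2.2 ∧ G.Adj p.2.2 p.1}
  have htrace : (G.adjMatrix ℝ ^ 3).trace = (T.card : ℝ) := by
    simp only [T, Finset.card_filter, Nat.cast_sum, Fintype.sum_prod_type, Matrix.trace,
      Matrix.diag_apply, pow_three, Matrix.mul_apply, adjMatrix_apply, Finset.mul_sum]
    refine Finset.sum_congr rfl fun a _ ↦ Finset.sum_congr rfl fun b _ ↦
      Finset.sum_congr rfl fun c _ ↦ ?_
    by_cases h₁ : G.Adj a b <;> by_cases h₂ : G.Adj b c <;> by_cases h₃ : G.Adj c a <;>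
      simp [h₁, h₂, h₃]
  have hmaps : ∀ p ∈ T, ({p.1, p.2.1, p.2.2} : Finset V) ∈ G.cliqueFinset 3 := by
    rintro ⟨a, b, c⟩ hp
    obtain ⟨hab, hbc, hca⟩ : G.Adj a b ∧ G.Adj b c ∧ G.Adj c a := by simpa [T] using hp
    exact mem_cliqueFinset_iff.2 (is3Clique_triple_iff.2 ⟨hab, hca.symm, hbc⟩)
  have hcard : T.card ≤ 6 * (G.cliqueFinset 3).card := by
    refine Finset.card_le_mul_card_image_of_maps_to hmaps 6 fun s hs ↦ ?_
    obtain ⟨x, y, z, -, -, -, rfl⟩ := is3Clique_iff.1 (mem_cliqueFinset_iff.1 hs)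
    refine (Finset.card_le_card (t := {(x, y, z), (x, z, y), (y, x, z), (y, z, x), (z, x, y),
      (z, y, x)}) ?_).trans Finset.card_le_six
    rintro ⟨a, b, c⟩ hp
    obtain ⟨⟨hab, hbc, hca⟩, heq⟩ : (G.Adj a b ∧ G.Adj b c ∧ G.Adj c a) ∧
        ({a, b, c} : Finset V) = {x, y, z} := by simpa [T] using hp
    have ha : a ∈ ({x, y, z} : Finset V) := by simp [← heq]
    have hb : b ∈ ({x, y, z} : Finset V) := by simp [← heq]
    have hc : c ∈ ({x, y, z} : Finset V) := by simp [← heq]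
    have := hab.ne
    have := hbc.ne
    have := hca.ne
    simp only [Finset.mem_insert, Finset.mem_singleton, Prod.mk.injEq] at ha hb hc ⊢
    grind
  rw [htrace]
  exact_mod_cast hcard

end SimpleGraph

/-- For a finite simple graph `G` with `n ≥ 1` vertices, `m` edges,
degrees `dᵢ` and `η` triangles, the Laplacian Estrada index
`LEE(G) = ∑ e^{μᵢ − 2m/n}` satisfies
`LEE(G) ≥ n + (1/6)·∑ dᵢ³ + (1 − m/n)·∑ dᵢ² + m + 8m³/(3n²) − 4m²/n − η`. -/
theorem stmt_10 (n : ℕ) (hn : 1 ≤ n) (G : SimpleGraph (Fin n)) [DecidableRel G.Adj]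
    (hL : (G.lapMatrix ℝ).IsHermitian) (m : ℝ) (hm : m = G.edgeFinset.card) :
    (n : ℝ) + (1 / 6) * ∑ i, (G.degree i : ℝ) ^ 3
        + (1 - m / n) * ∑ i, (G.degree i : ℝ) ^ 2
        + m + 8 * m ^ 3 / (3 * (n : ℝ) ^ 2) - 4 * m ^ 2 / n
        - ((G.cliqueFinset 3).card : ℝ)
      ≤ ∑ i, Real.exp (hL.eigenvalues i - 2 * m / n) := by
  have hn₀ : (n : ℝ) ≠ 0 := by positivity
  have hdeg : ∑ i, (G.degree i : ℝ) = 2 * m := by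
    rw [hm]
    exact_mod_cast G.sum_degrees_eq_twice_card_edges
  have h₁ : ∑ i, hL.eigenvalues i = 2 * m := by
    simpa [G.trace_lapMatrix, hdeg] using (hL.trace_pow_eq_sum_eigenvalues_pow 1).symm
  have h₂ := hL.trace_pow_eq_sum_eigenvalues_pow 2
  have h₃ := hL.trace_pow_eq_sum_eigenvalues_pow 3
  rw [G.trace_lapMatrix_sq, hdeg] at h₂
  rw [G.trace_lapMatrix_cube] at h₃
  have hη := G.trace_adjMatrix_cube_le
  refine le_trans ?_ (Finset.sum_le_sum fun i _ ↦
    Real.cubic_le_exp (hL.eigenvalues i - 2 * m / n))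
  set a : ℝ := 2 * m / n with ha
  have hexpand : ∑ i, (1 + (hL.eigenvalues i - a) + (hL.eigenvalues i - a) ^ 2 / 2
      + (hL.eigenvalues i - a) ^ 3 / 6)
      = n * (1 - a + a ^ 2 / 2 - a ^ 3 / 6) + (1 - a + a ^ 2 / 2) * ∑ i, hL.eigenvalues i
        + (1 - a) / 2 * ∑ i, hL.eigenvalues i ^ 2 + 1 / 6 * ∑ i, hL.eigenvalues i ^ 3 := by
    have hconst : (n : ℝ) * (1 - a + a ^ 2 / 2 - a ^ 3 / 6)
        = ∑ _i : Fin n, (1 - a + a ^ 2 / 2 - a ^ 3 / 6) := by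
      rw [Finset.sum_const, Finset.card_univ, Fintype.card_fin, nsmul_eq_mul]
    rw [hconst]
    simp only [Finset.mul_sum, ← Finset.sum_add_distrib]
    exact Finset.sum_congr rfl fun i _ ↦ by ring
  rw [hexpand, h₁, ← h₂, ← h₃]
  generalize ∑ i, (G.degree i : ℝ) ^ 3 = S₃ at *
  generalize ∑ i, (G.degree i : ℝ) ^ 2 = S₂ at *
  have hpoly : n * (1 - a + a ^ 2 / 2 - a ^ 3 / 6) + (1 - a + a ^ 2 / 2) * (2 * m)
      + (1 - a) / 2 * (S₂ + 2 * m) + 1 / 6 * (S₃ + 3 * S₂)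
      = n + 1 / 6 * S₃ + (1 - m / n) * S₂ + m + 8 * m ^ 3 / (3 * (n : ℝ) ^ 2)
        - 4 * m ^ 2 / n := by
    rw [ha]
    field_simp
    ring
  linarith
end

section
/- Let G be a connected finite simple graph with n vertices and m edges satisfying n ≥ m ≥ 3. Then the Laplacian Estrada index satisfies LEE(G) ≥ n + m − 1, and moreover n + m − 1 > √(n² + 4m); in particular LEE(G) > √(n² + 4m). -/
open Matrix in
/-- The power sums of the eigenvalues of a real symmetric matrix are the traces of its powers. -/
theorem Matrix.IsHermitian.sum_eigenvalues_pow {V : Type*} [Fintype V] [DecidableEq V]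
    {A : Matrix V V ℝ} (hA : A.IsHermitian) (k : ℕ) :
    ∑ i, hA.eigenvalues i ^ k = (A ^ k).trace := by
  conv_rhs => rw [hA.spectral_theorem, ← map_pow, Unitary.conjStarAlgAut_apply, trace_mul_cycle,
    Unitary.coe_star_mul_self, one_mul, diagonal_pow, trace_diagonal]
  simp

namespace SimpleGraph

variable {V : Type*} [Fintype V] [DecidableEq V] (G : SimpleGraph V) [DecidableRel G.Adj]

/-- In a connected graph with at most as many edges as vertices, every edge of a triangle lies in
every other triangle. -/
theorem Connected.mem_of_adj_of_card_le {G : SimpleGraph V} [DecidableRel G.Adj]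
    (hG : G.Connected) (hcard : G.edgeFinset.card ≤ Fintype.card V) {a b c x y z : V}
    (hab : G.Adj a b) (hbc : G.Adj b c) (hca : G.Adj c a)
    (hxy : G.Adj x y) (hyz : G.Adj y z) (hzx : G.Adj z x) :
    a ∈ ({x, y, z} : Finset V) ∧ b ∈ ({x, y, z} : Finset V) := by
  have hbr : ¬ G.IsBridge s(a, b) := by
    rw [isBridge_iff, not_not]
    have hac : (G.deleteEdges {s(a, b)}).Adj a c := by
      have := hca.ne
      have := hbc.ne
      simp only [deleteEdges_adj, Set.mem_singleton_iff, Sym2.eq_iff]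
      grind [hca.symm]
    have hcb : (G.deleteEdges {s(a, b)}).Adj c b := by
      have := hca.ne
      have := hbc.ne
      simp only [deleteEdges_adj, Set.mem_singleton_iff, Sym2.eq_iff]
      grind [hbc.symm]
    exact hac.reachable.trans hcb.reachable
  have hconn := hG.connected_delete_edge_of_not_isBridge hbr
  have hlt : (G.deleteEdges {s(a, b)}).edgeFinset.card < G.edgeFinset.card := by
    refine Finset.card_lt_card (edgeFinset_ssubset_edgeFinset.2 ?_)
    refine (deleteEdges_le _).lt_of_ne fun h ↦ ?_
    have : ¬ (G.deleteEdges {s(a, b)}).Adj a b := by simp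
    rw [h] at this
    exact this hab
  have htree : (G.deleteEdges {s(a, b)}).IsTree := by
    refine isTree_iff_connected_and_card.2 ⟨hconn, ?_⟩
    have h := hconn.card_vert_le_card_edgeSet_add_one
    rw [Nat.card_eq_fintype_card, Nat.card_eq_fintype_card, ← edgeFinset_card] at h ⊢
    omega
  have hfree := htree.isAcyclic.cliqueFree le_rfl
  by_contra hcon
  refine hfree {x, y, z} (is3Clique_triple_iff.2 ?_)
  simp only [deleteEdges_adj, Set.mem_singleton_iff, Sym2.eq_iff]
  simp only [Finset.mem_insert, Finset.mem_singleton] at hcon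
  grind [hzx.symm]

/-- A connected graph with at most as many edges as vertices has at most one triangle. -/
theorem Connected.trace_adjMatrix_pow_three_le {G : SimpleGraph V} [DecidableRel G.Adj]
    (hG : G.Connected) (hcard : G.edgeFinset.card ≤ Fintype.card V) :
    (G.adjMatrix ℝ ^ 3).trace ≤ 6 := by
  have htr : (G.adjMatrix ℝ ^ 3).trace = ((Finset.univ.filter fun p : V × V × V ↦
      G.Adj p.1 p.2.1 ∧ G.Adj p.2.1 p.2.2 ∧ G.Adj p.2.2 p.1).card : ℝ) := by
    rw [Finset.card_filter, Nat.cast_sum, Fintype.sum_prod_type, pow_three, Matrix.trace]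
    refine Finset.sum_congr rfl fun i _ ↦ ?_
    rw [Fintype.sum_prod_type, Matrix.diag_apply, Matrix.mul_apply]
    refine Finset.sum_congr rfl fun j _ ↦ ?_
    rw [Matrix.mul_apply, Finset.mul_sum]
    refine Finset.sum_congr rfl fun k _ ↦ ?_
    simp only [adjMatrix_apply]
    split_ifs <;> simp_all
  rw [htr]
  rcases (Finset.univ.filter fun p : V × V × V ↦
      G.Adj p.1 p.2.1 ∧ G.Adj p.2.1 p.2.2 ∧ G.Adj p.2.2 p.1).eq_empty_or_nonempty with he | ⟨p, hp⟩
  · simp [he]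
  obtain ⟨a, b, c⟩ := p
  obtain ⟨hab, hbc, hca⟩ : G.Adj a b ∧ G.Adj b c ∧ G.Adj c a := by simpa using hp
  have hsub : (Finset.univ.filter fun p : V × V × V ↦
      G.Adj p.1 p.2.1 ∧ G.Adj p.2.1 p.2.2 ∧ G.Adj p.2.2 p.1) ⊆
      {(a, b, c), (a, c, b), (b, a, c), (b, c, a), (c, a, b), (c, b, a)} := by
    rintro ⟨x, y, z⟩ h
    obtain ⟨hxy, hyz, hzx⟩ : G.Adj x y ∧ G.Adj y z ∧ G.Adj z x := by simpa using h
    obtain ⟨hx, hy⟩ := hG.mem_of_adj_of_card_le hcard hxy hyz hzx hab hbc hca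
    obtain ⟨-, hz⟩ := hG.mem_of_adj_of_card_le hcard hyz hzx hxy hab hbc hca
    have := hxy.ne
    have := hyz.ne
    have := hzx.ne
    simp only [Finset.mem_insert, Finset.mem_singleton, Prod.mk.injEq] at *
    grind
  exact_mod_cast (Finset.card_le_card hsub).trans Finset.card_le_six

theorem trace_lapMatrix_eq_sum_degree : (G.lapMatrix ℝ).trace = ∑ v, (G.degree v : ℝ) := by
  simp [lapMatrix, degMatrix]

theorem trace_lapMatrix_pow_two :
    (G.lapMatrix ℝ ^ 2).trace = ∑ v, ((G.degree v : ℝ) ^ 2 + G.degree v) := by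
  have h : G.lapMatrix ℝ ^ 2 = G.degMatrix ℝ * G.degMatrix ℝ - G.degMatrix ℝ * G.adjMatrix ℝ
      - G.adjMatrix ℝ * G.degMatrix ℝ + G.adjMatrix ℝ * G.adjMatrix ℝ := by
    rw [lapMatrix]; noncomm_ring
  have hA : (G.adjMatrix ℝ * G.adjMatrix ℝ).trace = ∑ v, (G.degree v : ℝ) := by
    simp only [Matrix.trace, Matrix.diag_apply, adjMatrix_mul_self_apply_self]
  have hDA : (G.degMatrix ℝ * G.adjMatrix ℝ).trace = 0 := by
    simp only [degMatrix, Matrix.trace, Matrix.diag_apply, Matrix.diagonal_mul]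
    simp
  rw [h, Matrix.trace_add, Matrix.trace_sub, Matrix.trace_sub, hA,
    Matrix.trace_mul_comm (G.adjMatrix ℝ), hDA, Finset.sum_add_distrib]
  simp [degMatrix, sq]

theorem trace_lapMatrix_pow_three_s11 :
    (G.lapMatrix ℝ ^ 3).trace =
      ∑ v, ((G.degree v : ℝ) ^ 3 + 3 * (G.degree v : ℝ) ^ 2) - (G.adjMatrix ℝ ^ 3).trace := by
  have h : G.lapMatrix ℝ ^ 3 =
      G.degMatrix ℝ * (G.degMatrix ℝ * G.degMatrix ℝ)
      - G.degMatrix ℝ * (G.degMatrix ℝ * G.adjMatrix ℝ)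
      - G.degMatrix ℝ * G.adjMatrix ℝ * G.degMatrix ℝ
      - G.adjMatrix ℝ * (G.degMatrix ℝ * G.degMatrix ℝ)
      + G.degMatrix ℝ * (G.adjMatrix ℝ * G.adjMatrix ℝ)
      + G.adjMatrix ℝ * (G.degMatrix ℝ * G.adjMatrix ℝ)
      + G.adjMatrix ℝ * G.adjMatrix ℝ * G.degMatrix ℝ
      - G.adjMatrix ℝ ^ 3 := by
    rw [lapMatrix]; noncomm_ring
  have hD : (G.degMatrix ℝ * (G.degMatrix ℝ * G.degMatrix ℝ)).trace =
      ∑ v, (G.degree v : ℝ) ^ 3 := by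
    simp [degMatrix, pow_three]
  have hDA : (G.degMatrix ℝ * (G.degMatrix ℝ * G.adjMatrix ℝ)).trace = 0 := by
    simp only [degMatrix, Matrix.trace, Matrix.diag_apply, Matrix.diagonal_mul]
    simp
  have hAA : (G.degMatrix ℝ * (G.adjMatrix ℝ * G.adjMatrix ℝ)).trace =
      ∑ v, (G.degree v : ℝ) ^ 2 := by
    simp only [degMatrix, Matrix.trace, Matrix.diag_apply, Matrix.diagonal_mul,
      adjMatrix_mul_self_apply_self, sq]
  have h₁ : (G.degMatrix ℝ * G.adjMatrix ℝ * G.degMatrix ℝ).trace = 0 := by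
    rw [Matrix.trace_mul_comm, hDA]
  have h₂ : (G.adjMatrix ℝ * (G.degMatrix ℝ * G.degMatrix ℝ)).trace = 0 := by
    rw [Matrix.trace_mul_comm, Matrix.mul_assoc, hDA]
  have h₃ : (G.adjMatrix ℝ * (G.degMatrix ℝ * G.adjMatrix ℝ)).trace =
      ∑ v, (G.degree v : ℝ) ^ 2 := by
    rw [Matrix.trace_mul_comm, Matrix.mul_assoc, hAA]
  have h₄ : (G.adjMatrix ℝ * G.adjMatrix ℝ * G.degMatrix ℝ).trace =
      ∑ v, (G.degree v : ℝ) ^ 2 := by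
    rw [Matrix.trace_mul_comm, hAA]
  rw [h]
  simp only [Matrix.trace_add, Matrix.trace_sub, hD, hDA, hAA, h₁, h₂, h₃, h₄,
    Finset.sum_add_distrib, ← Finset.mul_sum]
  ring

/-- Lower bound for the Laplacian Estrada index of a connected graph with at most as many edges
as vertices. -/
theorem Connected.card_add_card_edgeFinset_sub_one_le {G : SimpleGraph V} [DecidableRel G.Adj]
    (hG : G.Connected) (hcard : G.edgeFinset.card ≤ Fintype.card V)
    (hL : (G.lapMatrix ℝ).IsHermitian) :
    (Fintype.card V : ℝ) + G.edgeFinset.card - 1 ≤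
      ∑ i, Real.exp (hL.eigenvalues i - 2 * G.edgeFinset.card / Fintype.card V) := by
  have hn : (0 : ℝ) < Fintype.card V := by
    have := hG.nonempty
    exact_mod_cast Fintype.card_pos
  set c : ℝ := 2 * G.edgeFinset.card / Fintype.card V with hc
  have hc₂ : c ≤ 2 := by
    rw [hc, div_le_iff₀ hn]
    have : (G.edgeFinset.card : ℝ) ≤ Fintype.card V := by exact_mod_cast hcard
    linarith
  have hcn : Fintype.card V * c = 2 * G.edgeFinset.card := by
    rw [hc]; field_simp
  have hdeg : ∑ v, (G.degree v : ℝ) = 2 * G.edgeFinset.card := by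
    exact_mod_cast G.sum_degrees_eq_twice_card_edges
  have h₁ : ∑ i, hL.eigenvalues i = ∑ v, (G.degree v : ℝ) := by
    rw [← G.trace_lapMatrix_eq_sum_degree]
    simpa using hL.sum_eigenvalues_pow 1
  have h₂ := (hL.sum_eigenvalues_pow 2).trans G.trace_lapMatrix_pow_two
  have h₃ := (hL.sum_eigenvalues_pow 3).trans G.trace_lapMatrix_pow_three_s11
  have htri := hG.trace_adjMatrix_pow_three_le hcard
  have hsq : 0 ≤ ∑ v, ((G.degree v : ℝ) - c) ^ 2 := Finset.sum_nonneg fun v _ ↦ sq_nonneg _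
  have hcube : 0 ≤ ∑ v, ((G.degree v : ℝ) - c) ^ 2 * ((G.degree v : ℝ) - c + 3) :=
    Finset.sum_nonneg fun v _ ↦ mul_nonneg (sq_nonneg _) (by
      have : (0 : ℝ) ≤ G.degree v := Nat.cast_nonneg _
      linarith)
  have hexp : ∑ i, (1 + (hL.eigenvalues i - c) + (hL.eigenvalues i - c) ^ 2 / 2 +
      (hL.eigenvalues i - c) ^ 3 / 6) ≤ ∑ i, Real.exp (hL.eigenvalues i - c) :=
    Finset.sum_le_sum fun i _ ↦ Real.cubic_le_exp _
  refine le_trans ?_ hexp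
  have hE : ∑ i, (1 + (hL.eigenvalues i - c) + (hL.eigenvalues i - c) ^ 2 / 2 +
      (hL.eigenvalues i - c) ^ 3 / 6) =
      Fintype.card V * (1 - c + c ^ 2 / 2 - c ^ 3 / 6) +
      (1 - c + c ^ 2 / 2) * ∑ i, hL.eigenvalues i +
      (1 / 2 - c / 2) * ∑ i, hL.eigenvalues i ^ 2 + 1 / 6 * ∑ i, hL.eigenvalues i ^ 3 := by
    rw [Finset.mul_sum, Finset.mul_sum, Finset.mul_sum, ← nsmul_eq_mul, ← Finset.card_univ,
      ← Finset.sum_const, ← Finset.sum_add_distrib, ← Finset.sum_add_distrib,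
      ← Finset.sum_add_distrib]
    exact Finset.sum_congr rfl fun i _ ↦ by ring
  have hsq' : ∑ v, ((G.degree v : ℝ) - c) ^ 2 = ∑ v, (G.degree v : ℝ) ^ 2
      - 2 * c * ∑ v, (G.degree v : ℝ) + Fintype.card V * c ^ 2 := by
    rw [Finset.mul_sum, ← nsmul_eq_mul, ← Finset.card_univ, ← Finset.sum_const,
      ← Finset.sum_sub_distrib, ← Finset.sum_add_distrib]
    exact Finset.sum_congr rfl fun i _ ↦ by ring
  have hcube' : ∑ v, ((G.degree v : ℝ) - c) ^ 2 * ((G.degree v : ℝ) - c + 3) =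
      ∑ v, (G.degree v : ℝ) ^ 3 + (3 - 3 * c) * ∑ v, (G.degree v : ℝ) ^ 2
      + (3 * c ^ 2 - 6 * c) * ∑ v, (G.degree v : ℝ) + Fintype.card V * (3 * c ^ 2 - c ^ 3) := by
    rw [Finset.mul_sum, Finset.mul_sum, ← nsmul_eq_mul, ← Finset.card_univ, ← Finset.sum_const,
      ← Finset.sum_add_distrib, ← Finset.sum_add_distrib, ← Finset.sum_add_distrib]
    exact Finset.sum_congr rfl fun i _ ↦ by ring
  rw [Finset.sum_add_distrib] at h₂
  rw [Finset.sum_add_distrib, ← Finset.mul_sum] at h₃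
  rw [hsq'] at hsq
  rw [hcube'] at hcube
  rw [hE, h₁, h₂, h₃]
  rw [hdeg, ← hcn] at hsq hcube ⊢
  linarith

end SimpleGraph

/-- Let `G` be a connected finite simple graph with `n` vertices and
`m` edges, `n ≥ m ≥ 3`. Then `LEE(G) ≥ n + m − 1`, and `n + m − 1 > √(n² + 4m)`;
in particular `LEE(G) > √(n² + 4m)`. -/
theorem stmt_11 (n : ℕ) (G : SimpleGraph (Fin n)) [DecidableRel G.Adj]
    (hconn : G.Connected) (hm3 : 3 ≤ G.edgeFinset.card) (hmn : G.edgeFinset.card ≤ n)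
    (hL : (G.lapMatrix ℝ).IsHermitian) (m : ℝ) (hm : m = G.edgeFinset.card) :
    (n : ℝ) + m - 1 ≤ ∑ i, Real.exp (hL.eigenvalues i - 2 * m / n) ∧
    Real.sqrt ((n : ℝ) ^ 2 + 4 * m) < (n : ℝ) + m - 1 ∧
    Real.sqrt ((n : ℝ) ^ 2 + 4 * m) < ∑ i, Real.exp (hL.eigenvalues i - 2 * m / n) := by
  have hsqrt : Real.sqrt ((n : ℝ) ^ 2 + 4 * m) < (n : ℝ) + m - 1 := by
    have hm₃ : (3 : ℝ) ≤ m := by rw [hm]; exact_mod_cast hm3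
    have hmn' : m ≤ n := by rw [hm]; exact_mod_cast hmn
    rw [Real.sqrt_lt' (by linarith)]
    nlinarith [mul_nonneg (sub_nonneg.2 hmn') (sub_nonneg.2 hm₃)]
  have hLEE : (n : ℝ) + m - 1 ≤ ∑ i, Real.exp (hL.eigenvalues i - 2 * m / n) := by
    subst hm
    simpa using hconn.card_add_card_edgeFinset_sub_one_le (by simpa using hmn) hL
  exact ⟨hLEE, hsqrt, hsqrt.trans_le hLEE⟩
end

section
/- Let G be a connected finite simple graph with n vertices and m edges satisfying n ≥ m. Then G has at most one triangle, i.e., the number of 3-cliques of G is at most 1. -/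
namespace SimpleGraph

variable {V : Type*} {G : SimpleGraph V} {a b c : V}

/-- An edge of a triangle is not a bridge. -/
lemma not_isBridge_of_adj_of_adj (hab : G.Adj a b) (hac : G.Adj a c) (hcb : G.Adj c b) :
    ¬ G.IsBridge s(a, b) := by
  rw [isBridge_iff, not_not]
  have h₁ : (G.deleteEdges {s(a, b)}).Adj a c := by
    simp [deleteEdges_adj, hac, hcb.ne, hab.ne]
  have h₂ : (G.deleteEdges {s(a, b)}).Adj c b := by
    simp [deleteEdges_adj, hcb, hac.ne', hcb.ne]
  exact h₁.reachable.trans h₂.reachable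

/-- In a connected graph with at most as many edges as vertices, deleting an edge that is not a
bridge leaves a tree. -/
lemma Connected.isTree_deleteEdges_of_not_isBridge [Finite V] (hG : G.Connected)
    (hcard : Nat.card G.edgeSet ≤ Nat.card V) (hab : G.Adj a b) (h : ¬ G.IsBridge s(a, b)) :
    (G.deleteEdges {s(a, b)}).IsTree := by
  have hconn := hG.connected_delete_edge_of_not_isBridge h
  refine isTree_iff_connected_and_card.2 ⟨hconn, ?_⟩
  have hle := hconn.card_vert_le_card_edgeSet_add_one
  have hdel : Nat.card (G.deleteEdges {s(a, b)}).edgeSet + 1 = Nat.card G.edgeSet := by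
    rw [edgeSet_deleteEdges, Nat.card_coe_set_eq, Nat.card_coe_set_eq]
    exact Set.ncard_sdiff_singleton_add_one (by simpa using hab) (Set.toFinite _)
  omega

/-- A connected graph with at most as many edges as vertices has at most one triangle. -/
lemma Connected.is3Clique_unique [Finite V] (hG : G.Connected)
    (hcard : Nat.card G.edgeSet ≤ Nat.card V) {s t : Finset V}
    (hs : G.IsNClique 3 s) (ht : G.IsNClique 3 t) : s = t := by
  classical
  by_contra hne
  have hst : ¬ s ⊆ t := fun h =>
    hne (Finset.eq_of_subset_of_card_le h (by rw [hs.card_eq, ht.card_eq]))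
  obtain ⟨a, has, hat⟩ := Finset.not_subset.1 hst
  obtain ⟨b, c, hbc, hsbc⟩ := Finset.card_eq_two.1
    (by rw [Finset.card_erase_of_mem has, hs.card_eq] : (s.erase a).card = 2)
  have hb : b ∈ s.erase a := by simp [hsbc]
  have hc : c ∈ s.erase a := by simp [hsbc]
  rw [Finset.mem_erase] at hb hc
  have hab : G.Adj a b := hs.isClique has hb.2 hb.1.symm
  have hac : G.Adj a c := hs.isClique has hc.2 hc.1.symm
  have hcb : G.Adj c b := hs.isClique hc.2 hb.2 hbc.symm
  have hT := hG.isTree_deleteEdges_of_not_isBridge hcard hab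
    (not_isBridge_of_adj_of_adj hab hac hcb)
  refine hT.isAcyclic.cliqueFree le_rfl t ⟨fun x hx y hy hxy => ?_, ht.card_eq⟩
  rw [deleteEdges_adj]
  refine ⟨ht.isClique hx hy hxy, fun h => hat ?_⟩
  rcases Sym2.eq_iff.1 (Set.mem_singleton_iff.1 h) with ⟨rfl, -⟩ | ⟨-, rfl⟩
  · exact hx
  · exact hy

end SimpleGraph

/-- A connected finite simple graph with `n` vertices and at most `n`
edges has at most one triangle. -/
theorem stmt_12 (n : ℕ) (G : SimpleGraph (Fin n)) [DecidableRel G.Adj]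
    (hconn : G.Connected) (hmn : G.edgeFinset.card ≤ n) :
    (G.cliqueFinset 3).card ≤ 1 := by
  refine Finset.card_le_one.2 fun s hs t ht => hconn.is3Clique_unique ?_
    (SimpleGraph.mem_cliqueFinset_iff.1 hs) (SimpleGraph.mem_cliqueFinset_iff.1 ht)
  rwa [Nat.card_eq_fintype_card, ← SimpleGraph.edgeFinset_card, Nat.card_fin]
end

section
/- Let G be a finite simple graph with n ≥ 1 vertices and m edges, and let T = Σ_{i=1}^n μ_i² be the sum of squares of the Laplacian eigenvalues of G (equivalently T = 2m + Σ_{i=1}^n d_i²). Then the Laplacian Estrada index satisfies LEE(G) ≤ n − 1 − √(T − 4m²/n) + e^{√(T − 4m²/n)}. (This is the graph case of the paper's Theorem 5.1.) -/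
theorem Real.hasSum_exp_sub_one_sub (x : ℝ) :
    HasSum (fun k : ℕ => x ^ (k + 2) / (k + 2).factorial) (Real.exp x - 1 - x) := by
  have h : HasSum (fun k : ℕ => x ^ k / k.factorial) (Real.exp x) := by
    rw [Real.exp_eq_exp_ℝ]
    exact NormedSpace.expSeries_div_hasSum_exp x
  have h2 := (hasSum_nat_add_iff' 2).2 h
  simpa [Finset.sum_range_succ, sub_sub] using h2

/-- The function `(exp x - 1 - x) / x ^ 2` at `x` is at most its value at any `s ≥ |x|`. -/
theorem Real.sq_mul_exp_sub_one_sub_le {x s : ℝ} (h : |x| ≤ s) :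
    s ^ 2 * (Real.exp x - 1 - x) ≤ x ^ 2 * (Real.exp s - 1 - s) := by
  refine hasSum_le (fun k => ?_) ((Real.hasSum_exp_sub_one_sub x).mul_left (s ^ 2))
    ((Real.hasSum_exp_sub_one_sub s).mul_left (x ^ 2))
  have hk : x ^ k ≤ s ^ k :=
    (le_abs_self _).trans ((abs_pow x k).trans_le (pow_le_pow_left₀ (abs_nonneg x) h k))
  rw [← mul_div_assoc, ← mul_div_assoc]
  gcongr ?_ / _
  calc s ^ 2 * x ^ (k + 2) = (s ^ 2 * x ^ 2) * x ^ k := by ring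
    _ ≤ (s ^ 2 * x ^ 2) * s ^ k := by gcongr
    _ = x ^ 2 * s ^ (k + 2) := by ring

theorem Real.sum_exp_sub_one_sub_le {ι : Type*} (t : Finset ι) (x : ι → ℝ) :
    ∑ i ∈ t, (Real.exp (x i) - 1 - x i) ≤
      Real.exp √(∑ i ∈ t, x i ^ 2) - 1 - √(∑ i ∈ t, x i ^ 2) := by
  have hS : 0 ≤ ∑ i ∈ t, x i ^ 2 := Finset.sum_nonneg fun i _ => sq_nonneg _
  set s := √(∑ i ∈ t, x i ^ 2) with hs
  have hs2 : s ^ 2 = ∑ i ∈ t, x i ^ 2 := Real.sq_sqrt hS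
  have hx : ∀ i ∈ t, |x i| ≤ s := fun i hi =>
    Real.abs_le_sqrt (Finset.single_le_sum (f := fun i => x i ^ 2) (fun j _ => sq_nonneg _) hi)
  have hs0 : 0 ≤ s := Real.sqrt_nonneg _
  rcases hs0.eq_or_lt with h0 | hpos
  · rw [← h0]
    refine (Finset.sum_eq_zero fun i hi => ?_).trans_le (by simp)
    have : x i = 0 := abs_nonpos_iff.1 (h0 ▸ hx i hi)
    simp [this]
  · refine le_of_mul_le_mul_left ?_ (pow_pos hpos 2)
    rw [Finset.mul_sum]
    conv_rhs => rw [hs2, Finset.sum_mul]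
    exact Finset.sum_le_sum fun i hi => Real.sq_mul_exp_sub_one_sub_le (hx i hi)

theorem SimpleGraph.trace_lapMatrix_s13 {V : Type*} [Fintype V] [DecidableEq V] (G : SimpleGraph V)
    [DecidableRel G.Adj] : (G.lapMatrix ℝ).trace = 2 * G.edgeFinset.card := by
  have h : ∑ v, (G.degree v : ℝ) = 2 * G.edgeFinset.card := by
    exact_mod_cast G.sum_degrees_eq_twice_card_edges
  simp [SimpleGraph.lapMatrix, Matrix.trace_sub, SimpleGraph.degMatrix, Matrix.trace_diagonal, h]

/-- For a finite simple graph `G` with `n ≥ 1` vertices and `m` edges,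
with `T = ∑ μᵢ²` the sum of squares of the Laplacian eigenvalues, the Laplacian Estrada
index satisfies `LEE(G) ≤ n − 1 − √(T − 4m²/n) + e^{√(T − 4m²/n)}`. -/
theorem stmt_13 (n : ℕ) (hn : 1 ≤ n) (G : SimpleGraph (Fin n)) [DecidableRel G.Adj]
    (hL : (G.lapMatrix ℝ).IsHermitian) (m : ℝ) (hm : m = G.edgeFinset.card)
    (T : ℝ) (hT : T = ∑ i, (hL.eigenvalues i) ^ 2) :
    ∑ i, Real.exp (hL.eigenvalues i - 2 * m / n) ≤
      (n : ℝ) - 1 - Real.sqrt (T - 4 * m ^ 2 / n)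
        + Real.exp (Real.sqrt (T - 4 * m ^ 2 / n)) := by
  have hn0 : (n : ℝ) ≠ 0 := Nat.cast_ne_zero.2 (Nat.one_le_iff_ne_zero.1 hn)
  have htr : ∑ i, hL.eigenvalues i = 2 * m := by
    rw [hm, ← G.trace_lapMatrix_s13, hL.trace_eq_sum_eigenvalues]
    simp
  have hsum : ∑ i, (hL.eigenvalues i - 2 * m / n) = 0 := by
    rw [Finset.sum_sub_distrib, htr]
    simp
    field_simp
    ring
  have hsq : ∑ i, (hL.eigenvalues i - 2 * m / n) ^ 2 = T - 4 * m ^ 2 / n := by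
    simp only [sub_sq, Finset.sum_add_distrib, Finset.sum_sub_distrib, ← Finset.sum_mul,
      ← Finset.mul_sum, htr, ← hT, Finset.sum_const, Finset.card_univ, Fintype.card_fin,
      nsmul_eq_mul]
    field_simp
    ring
  have key := Real.sum_exp_sub_one_sub_le Finset.univ fun i => hL.eigenvalues i - 2 * m / n
  rw [hsq, Finset.sum_sub_distrib, Finset.sum_sub_distrib, hsum] at key
  simp only [Finset.sum_const, Finset.card_univ, Fintype.card_fin, nsmul_eq_mul] at key
  linarith
end

section
/- Let G be a finite simple graph with n ≥ 1 vertices and m edges, with Laplacian eigenvalues μ_1, ..., μ_n. Set M₂ = Σ_{i=1}^n (μ_i − 2m/n)² and let LE(G) = Σ_{i=1}^n |μ_i − 2m/n| be the Laplacian energy. Then LEE(G) ≤ n + (1/2)·M₂ − 1 − LE(G) − (1/2)·LE(G)² + e^{LE(G)}, with equality if and only if G has no edges. (This is the graph case of the paper's Theorem 5.4.) -/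
/-- The exponential remainder `exp x - 1 - x - x ^ 2 / 2`. -/
noncomputable def expRemainder (x : ℝ) : ℝ := Real.exp x - 1 - x - x ^ 2 / 2

theorem expRemainder_zero : expRemainder 0 = 0 := by simp [expRemainder]

theorem expRemainder_add_le {x y : ℝ} (hx : 0 ≤ x) (hy : 0 ≤ y) :
    expRemainder x + expRemainder y ≤ expRemainder (x + y) := by
  have hx1 : x ≤ Real.exp x - 1 := by linarith [Real.add_one_le_exp x]
  have hy1 : y ≤ Real.exp y - 1 := by linarith [Real.add_one_le_exp y]
  have h := mul_le_mul hx1 hy1 hy (hx.trans hx1)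
  simp only [expRemainder, Real.exp_add]
  nlinarith

theorem sum_expRemainder_le {ι : Type*} (s : Finset ι) (f : ι → ℝ) (hf : ∀ i ∈ s, 0 ≤ f i) :
    ∑ i ∈ s, expRemainder (f i) ≤ expRemainder (∑ i ∈ s, f i) := by
  classical
  induction s using Finset.induction_on with
  | empty => simp [expRemainder_zero]
  | insert i s hi ih =>
    rw [Finset.sum_insert hi, Finset.sum_insert hi]
    have hs : ∀ j ∈ s, 0 ≤ f j := fun j hj => hf j (Finset.mem_insert_of_mem hj)
    have h := expRemainder_add_le (hf i (Finset.mem_insert_self i s)) (Finset.sum_nonneg hs)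
    linarith [ih hs]

theorem expRemainder_lt_abs {x : ℝ} (hx : x < 0) : expRemainder x < expRemainder |x| := by
  have h := Real.self_lt_sinh_iff.2 (neg_pos.2 hx)
  rw [Real.sinh_eq, neg_neg] at h
  rw [abs_of_neg hx]
  simp only [expRemainder]
  nlinarith

theorem expRemainder_le_abs (x : ℝ) : expRemainder x ≤ expRemainder |x| := by
  rcases lt_or_ge x 0 with hx | hx
  · exact (expRemainder_lt_abs hx).le
  · rw [abs_of_nonneg hx]

theorem sum_expRemainder_le_abs {ι : Type*} [Fintype ι] (a : ι → ℝ) :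
    ∑ i, expRemainder (a i) ≤ expRemainder (∑ i, |a i|) :=
  (Finset.sum_le_sum fun i _ => expRemainder_le_abs (a i)).trans
    (sum_expRemainder_le _ _ fun i _ => abs_nonneg (a i))

theorem sum_expRemainder_eq_abs_iff {ι : Type*} [Fintype ι] {a : ι → ℝ} (ha : ∑ i, a i = 0) :
    ∑ i, expRemainder (a i) = expRemainder (∑ i, |a i|) ↔ ∀ i, a i = 0 := by
  refine ⟨fun h => ?_, fun h => by simp [h, expRemainder_zero]⟩
  have hnonneg : ∀ i, 0 ≤ a i := by
    by_contra! hneg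
    obtain ⟨i, hi⟩ := hneg
    refine h.not_lt (lt_of_lt_of_le (Finset.sum_lt_sum (fun j _ => expRemainder_le_abs (a j))
      ⟨i, Finset.mem_univ i, expRemainder_lt_abs hi⟩)
      (sum_expRemainder_le _ _ fun j _ => abs_nonneg (a j)))
  intro i
  exact (Finset.sum_eq_zero_iff_of_nonneg fun j _ => hnonneg j).1 ha i (Finset.mem_univ i)

namespace SimpleGraph

variable {V : Type*} [Fintype V] [DecidableEq V] (G : SimpleGraph V) [DecidableRel G.Adj]

theorem trace_lapMatrix_s14 : (G.lapMatrix ℝ).trace = 2 * (G.edgeFinset.card : ℝ) := by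
  rw [lapMatrix, Matrix.trace_sub, trace_adjMatrix, sub_zero, degMatrix, Matrix.trace_diagonal]
  exact_mod_cast G.sum_degrees_eq_twice_card_edges

theorem sum_eigenvalues_lapMatrix (hL : (G.lapMatrix ℝ).IsHermitian) :
    ∑ i, hL.eigenvalues i = 2 * (G.edgeFinset.card : ℝ) := by
  rw [← trace_lapMatrix_s14, hL.trace_eq_sum_eigenvalues]
  simp

theorem exists_eigenvalues_lapMatrix_eq_zero [Nonempty V] (hL : (G.lapMatrix ℝ).IsHermitian) :
    ∃ i, hL.eigenvalues i = 0 := by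
  have hdet : (G.lapMatrix ℝ).det = 0 := Matrix.exists_mulVec_eq_zero_iff.1
    ⟨fun _ => 1, fun h => one_ne_zero (congrFun h (Classical.arbitrary V)),
      G.lapMatrix_mulVec_const_eq_zero⟩
  rw [hL.det_eq_prod_eigenvalues, Finset.prod_eq_zero_iff] at hdet
  obtain ⟨i, -, hi⟩ := hdet
  exact ⟨i, by simpa using hi⟩

end SimpleGraph

/-- For a finite simple graph `G` with `n ≥ 1` vertices and `m` edges,
with `M₂ = ∑ (μᵢ − 2m/n)²` and Laplacian energy `LE(G) = ∑ |μᵢ − 2m/n|`, the Laplacian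
Estrada index satisfies `LEE(G) ≤ n + M₂/2 − 1 − LE − LE²/2 + e^{LE}`, with equality if
and only if `G` has no edges. -/
theorem stmt_14 (n : ℕ) (hn : 1 ≤ n) (G : SimpleGraph (Fin n)) [DecidableRel G.Adj]
    (hL : (G.lapMatrix ℝ).IsHermitian) (m : ℝ) (hm : m = G.edgeFinset.card)
    (M2 : ℝ) (hM2 : M2 = ∑ i, (hL.eigenvalues i - 2 * m / n) ^ 2)
    (LE : ℝ) (hLE : LE = ∑ i, |hL.eigenvalues i - 2 * m / n|) :
    (∑ i, Real.exp (hL.eigenvalues i - 2 * m / n) ≤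
      (n : ℝ) + (1 / 2) * M2 - 1 - LE - (1 / 2) * LE ^ 2 + Real.exp LE) ∧
    (∑ i, Real.exp (hL.eigenvalues i - 2 * m / n) =
      (n : ℝ) + (1 / 2) * M2 - 1 - LE - (1 / 2) * LE ^ 2 + Real.exp LE ↔
        G.edgeFinset = ∅) := by
  have : Nonempty (Fin n) := ⟨⟨0, hn⟩⟩
  have hn0 : (n : ℝ) ≠ 0 := by positivity
  have hsum : ∑ i, (hL.eigenvalues i - 2 * m / n) = 0 := by
    rw [Finset.sum_sub_distrib, G.sum_eigenvalues_lapMatrix hL, ← hm]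
    simp
    field_simp
    ring
  have hexp : ∑ i, Real.exp (hL.eigenvalues i - 2 * m / n) =
      n + 1 / 2 * M2 + ∑ i, expRemainder (hL.eigenvalues i - 2 * m / n) := by
    simp only [expRemainder, Finset.sum_sub_distrib _ (fun i => hL.eigenvalues i - 2 * m / n),
      Finset.sum_sub_distrib _ (fun i => (hL.eigenvalues i - 2 * m / n) ^ 2 / 2),
      Finset.sum_sub_distrib _ (fun _ => (1 : ℝ)), hsum, ← Finset.sum_div, ← hM2]
    simp
    ring
  have hrhs : (n : ℝ) + (1 / 2) * M2 - 1 - LE - (1 / 2) * LE ^ 2 + Real.exp LE =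
      n + 1 / 2 * M2 + expRemainder LE := by
    rw [expRemainder]
    ring
  rw [hexp, hrhs, hLE, add_le_add_iff_left, add_right_inj, sum_expRemainder_eq_abs_iff hsum]
  refine ⟨sum_expRemainder_le_abs _, fun h => ?_, fun h i => ?_⟩
  · obtain ⟨i, hi⟩ := G.exists_eigenvalues_lapMatrix_eq_zero hL
    have hm0 : m = 0 := by simpa [hi, hn0] using h i
    rw [hm0] at hm
    exact Finset.card_eq_zero.1 (by exact_mod_cast hm.symm)
  · have hm0 : m = 0 := by simp [hm, h]
    simp only [hm0, mul_zero, zero_div, sub_zero] at hsum ⊢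
    exact (Finset.sum_eq_zero_iff_of_nonneg fun j _ =>
      (G.posSemidef_lapMatrix ℝ).eigenvalues_nonneg j).1 hsum i (Finset.mem_univ i)
end

section
/- Let G be a finite simple graph with n ≥ 1 vertices, m edges, maximum degree d_1 and minimum degree d_n, and let T = 2m + Σ_{i=1}^n d_i² be the sum of squares of the Laplacian eigenvalues of G. Then T ≤ 2m + (d_1 + d_n)·2m − n·d_1·d_n, and consequently the upper bound n − 1 − √(T − 4m²/n) + e^{√(T − 4m²/n)} on LEE(G) from the graph case of Theorem 5.1 is at most n − 1 − √(s) + e^{√(s)} evaluated at s = 2m + (d_1 + d_n)·2m − n·d_1·d_n − 4m²/n, provided s ≥ T − 4m²/n ≥ 0 and the function t ↦ −√t + e^{√t} is monotone increasing for t ≥ 0. -/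
/-- The function `x ↦ exp x - x` is monotone on the nonnegative reals. -/
theorem exp_sub_self_le_exp_sub_self {x y : ℝ} (hx : 0 ≤ x) (hxy : x ≤ y) :
    Real.exp x - x ≤ Real.exp y - y := by
  have h : Real.exp y = Real.exp x * Real.exp (y - x) := by
    rw [← Real.exp_add, add_sub_cancel]
  nlinarith [Real.add_one_le_exp (y - x), Real.one_le_exp hx]

/-- If all degrees of a graph lie in `[a, b]`, then
`∑ deg(v)² ≤ (a + b) · 2 |E| - |V| a b`. -/
theorem SimpleGraph.sum_degree_sq_le {V : Type*} [Fintype V] (G : SimpleGraph V)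
    [DecidableRel G.Adj] {a b : ℝ} (ha : ∀ v, a ≤ G.degree v) (hb : ∀ v, G.degree v ≤ b) :
    ∑ v, (G.degree v : ℝ) ^ 2 ≤
      (a + b) * (2 * G.edgeFinset.card) - Fintype.card V * a * b := by
  have hdeg : ∑ v, (G.degree v : ℝ) = 2 * G.edgeFinset.card := by
    exact_mod_cast G.sum_degrees_eq_twice_card_edges
  calc ∑ v, (G.degree v : ℝ) ^ 2
      ≤ ∑ v, ((a + b) * G.degree v - a * b) := Finset.sum_le_sum fun v _ => by
        nlinarith [mul_nonneg (sub_nonneg.2 (ha v)) (sub_nonneg.2 (hb v))]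
    _ = (a + b) * (2 * G.edgeFinset.card) - Fintype.card V * a * b := by
        rw [Finset.sum_sub_distrib, ← Finset.mul_sum, hdeg]
        simp [mul_assoc]


/-- For a finite simple graph `G` with `n ≥ 1` vertices, `m` edges,
maximum degree `d1` and minimum degree `dn`, letting `T = 2m + ∑ dᵢ²` (the sum of
squares of the Laplacian eigenvalues), one has `T ≤ 2m + (d1 + dn)·2m − n·d1·dn`, and
consequently `n − 1 − √(T − 4m²/n) + e^{√(T − 4m²/n)} ≤ n − 1 − √s + e^{√s}` at
`s = 2m + (d1 + dn)·2m − n·d1·dn − 4m²/n`. -/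
theorem stmt_16 (n : ℕ) (hn : 1 ≤ n) (G : SimpleGraph (Fin n)) [DecidableRel G.Adj]
    (d1 dn : ℕ) (hd1 : IsGreatest (Set.range (fun i => G.degree i)) d1)
    (hdn : IsLeast (Set.range (fun i => G.degree i)) dn)
    (m : ℝ) (hm : m = G.edgeFinset.card)
    (T : ℝ) (hT : T = 2 * m + ∑ i, (G.degree i : ℝ) ^ 2)
    (s : ℝ) (hs : s = 2 * m + ((d1 : ℝ) + (dn : ℝ)) * (2 * m) - (n : ℝ) * d1 * dn
      - 4 * m ^ 2 / n) :
    T ≤ 2 * m + ((d1 : ℝ) + (dn : ℝ)) * (2 * m) - (n : ℝ) * d1 * dn ∧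
    (n : ℝ) - 1 - Real.sqrt (T - 4 * m ^ 2 / n)
        + Real.exp (Real.sqrt (T - 4 * m ^ 2 / n)) ≤
      (n : ℝ) - 1 - Real.sqrt s + Real.exp (Real.sqrt s) := by
  have hsum := G.sum_degree_sq_le (a := dn) (b := d1)
    (fun v => by exact_mod_cast hdn.2 ⟨v, rfl⟩) (fun v => by exact_mod_cast hd1.2 ⟨v, rfl⟩)
  rw [← hm, Fintype.card_fin] at hsum
  have hle : T ≤ 2 * m + ((d1 : ℝ) + (dn : ℝ)) * (2 * m) - (n : ℝ) * d1 * dn := by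
    rw [hT]
    linarith
  refine ⟨hle, ?_⟩
  have hsqrt : Real.sqrt (T - 4 * m ^ 2 / n) ≤ Real.sqrt s :=
    Real.sqrt_le_sqrt (by rw [hs]; linarith)
  linarith [exp_sub_self_le_exp_sub_self (Real.sqrt_nonneg _) hsqrt]
end
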